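/- arXiv:2012.11166 — 3 statements merged into one kernel-verified Lean document; each statement's English description precedes it below -/
import Mathlib

section
/- Assume q = 2, 1 ≤ s < d ≤ m, 2 ≤ r ≤ m−1, and ms ≥ d(m−r) + 1. Then for every F_2-linear subspace U ⊆ F_{2^m} of dimension d, at least a fraction 1/3 of the vectors of Ω lie outside bad(U); that is, 3·|Ω ∖ bad(U)| ≥ |Ω|. -/
open Finset

/-- `Ω`: the set of vectors in `E^k` whose entries are `F`-linearly independent. -/
def OmegaSet (F E : Type*) [Field F] [Field E] [Algebra F E] (k : ℕ) : Set (Fin k → E) :=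
  {x | LinearIndependent F x}

/-- `bad(U)`: the set of `x ∈ Ω` for which there is a not-all-zero tuple `u` with entries in `U`
such that `∑ⱼ uⱼ^{q^ℓ} xⱼ = 0` for all `1 ≤ ℓ ≤ s`. -/
def badSet (F : Type*) {E : Type*} [Field F] [Field E] [Algebra F E]
    (q s k : ℕ) (U : Set E) : Set (Fin k → E) :=
  {x | LinearIndependent F x ∧ ∃ u : Fin k → E, (∀ j, u j ∈ U) ∧ u ≠ 0 ∧
      ∀ ℓ : ℕ, 1 ≤ ℓ → ℓ ≤ s → ∑ j, u j ^ q ^ ℓ * x j = 0}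

/-- A surjective linear map between finite modules has kernel of cardinality `|V| / |W|`. -/
theorem ncard_ker_mul_card {R V W : Type*} [Ring R] [AddCommGroup V] [AddCommGroup W]
    [Module R V] [Module R W] (f : V →ₗ[R] W) (hf : Function.Surjective f) :
    {x | f x = 0}.ncard * Nat.card W = Nat.card V := by
  have h := f.toAddMonoidHom.ker.card_mul_index
  rw [AddSubgroup.index_ker, AddMonoidHom.range_eq_top.mpr hf, AddSubgroup.card_top] at h
  exact h

/-- Union bound for a set covered by a finite family of sets of controlled size. -/
theorem ncard_mul_le_of_subset_iUnion {α ι : Type*} [Finite α] [Fintype ι] {S : Set α}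
    {t : ι → Set α} {a b : ℕ} (hS : S ⊆ ⋃ i, t i) (ht : ∀ i, (t i).ncard * a ≤ b) :
    S.ncard * a ≤ Fintype.card ι * b := by
  calc S.ncard * a ≤ (∑ i, (t i).ncard) * a :=
        Nat.mul_le_mul_right a
          ((Set.ncard_le_ncard hS).trans (Set.ncard_iUnion_le_of_fintype t))
    _ = ∑ i, (t i).ncard * a := Finset.sum_mul _ _ _
    _ ≤ ∑ _i : ι, b := Finset.sum_le_sum fun i _ => ht i
    _ = Fintype.card ι * b := by simp

section Moore

variable {F E : Type*} [Field F] [Fintype F] [Field E] [Algebra F E]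

local notation "q" => Fintype.card F

theorem frobeniusAlgHom_pow_apply (n : ℕ) (x : E) :
    (FiniteField.frobeniusAlgHom F E ^ n) x = x ^ q ^ n := by
  simp [AlgHom.coe_pow, FiniteField.coe_frobeniusAlgHom, pow_iterate]

/-- A linearized polynomial with few terms vanishing on a large subspace is zero. -/
theorem linearized_eq_zero [Finite E] {s : ℕ} (W : Submodule F E) (hs : s ≤ Module.finrank F W)
    (c : Fin s → E) (hc : ∀ w ∈ W, ∑ ℓ, c ℓ * w ^ q ^ (ℓ.val + 1) = 0) : c = 0 := by
  classical
  have hq : 1 < q := Fintype.one_lt_card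
  rcases Nat.eq_zero_or_pos s with rfl | hs0
  · exact Subsingleton.elim _ _
  have := Fintype.ofFinite W
  let P : Polynomial E := ∑ ℓ, Polynomial.C (c ℓ) * Polynomial.X ^ q ^ ℓ.val
  have hP : P = 0 := by
    refine Polynomial.eq_zero_of_natDegree_lt_card_of_eval_eq_zero P
      (f := fun w : W => FiniteField.frobeniusAlgHom F E w)
      ((FiniteField.frobeniusAlgHom F E).toRingHom.injective.comp Subtype.val_injective) ?_ ?_
    · intro w
      rw [← hc w w.2, Polynomial.eval_finsetSum]
      refine Finset.sum_congr rfl fun ℓ _ => ?_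
      simp [← pow_mul, pow_succ']
    · have hcard : Fintype.card W = q ^ Module.finrank F W := Module.card_eq_pow_finrank
      rw [hcard]
      refine lt_of_le_of_lt (Polynomial.natDegree_sum_le_of_forall_le (n := q ^ (s - 1)) _ _ ?_)
        (Nat.pow_lt_pow_right hq (by omega))
      intro ℓ _
      exact (Polynomial.natDegree_C_mul_X_pow_le _ _).trans
        (Nat.pow_le_pow_right (by omega) (by omega))
  funext ℓ
  have h := congrArg (fun p => Polynomial.coeff p (q ^ ℓ.val)) hP
  simp only [P, Polynomial.finsetSum_coeff, Polynomial.coeff_C_mul_X_pow,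
    Polynomial.coeff_zero] at h
  rw [Finset.sum_eq_single ℓ] at h
  · simpa using h
  · intro i _ hi
    rw [if_neg]
    intro heq
    exact hi (Fin.ext (Nat.pow_right_injective hq heq.symm))
  · simp

/-- The Moore matrix of a linearly independent family is injective. -/
theorem moore_mulVec_eq_zero [Finite E] {t : ℕ} {b : Fin t → E} (hb : LinearIndependent F b)
    {y : Fin t → E} (hy : ∀ ℓ : Fin t, ∑ i, b i ^ q ^ (ℓ.val + 1) * y i = 0) : y = 0 := by
  by_contra hne
  let M : Matrix (Fin t) (Fin t) E := Matrix.of fun ℓ i => b i ^ q ^ (ℓ.val + 1)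
  have hdet : M.det = 0 := Matrix.exists_mulVec_eq_zero_iff.mp ⟨y, hne, funext hy⟩
  obtain ⟨c, hc0, hc⟩ := Matrix.exists_vecMul_eq_zero_iff.mpr hdet
  refine hc0 (linearized_eq_zero (Submodule.span F (Set.range b))
    (by rw [finrank_span_eq_card hb, Fintype.card_fin]) c ?_)
  intro w hw
  induction hw using Submodule.span_induction with
  | mem x hx =>
    obtain ⟨i, rfl⟩ := hx
    exact congrFun hc i
  | zero => simp
  | add x y _ _ hx hy =>
    simp only [← frobeniusAlgHom_pow_apply, map_add, mul_add, Finset.sum_add_distrib] at *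
    rw [hx, hy, add_zero]
  | smul a x _ hx =>
    simp only [← frobeniusAlgHom_pow_apply, map_smul, mul_smul_comm, ← Finset.smul_sum] at *
    rw [hx, smul_zero]

variable (F) in
/-- The linear map `x ↦ (∑ⱼ uⱼ^{q^ℓ} xⱼ)_{1 ≤ ℓ ≤ s}`. -/
noncomputable def mooreMap {k : ℕ} (s : ℕ)
    (u : Fin k → E) : (Fin k → E) →ₗ[E] (Fin s → E) :=
  Matrix.mulVecLin (Matrix.of fun ℓ j => u j ^ q ^ (ℓ.val + 1))

omit [Field F] [Algebra F E] in
theorem mooreMap_apply {k s : ℕ} (u x : Fin k → E) (ℓ : Fin s) :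
    mooreMap F s u x ℓ = ∑ j, u j ^ q ^ (ℓ.val + 1) * x j := rfl

/-- If the Moore map of `u` kills a linearly independent vector, then either `u = 0` or the span of
`u` is large. -/
theorem eq_zero_of_mooreMap_eq_zero [Finite E] {k s : ℕ} {u x : Fin k → E}
    (hx : LinearIndependent F x) (hu : Module.finrank F (Submodule.span F (Set.range u)) ≤ s)
    (h : mooreMap F s u x = 0) : u = 0 := by
  let W := Submodule.span F (Set.range u)
  let b := Module.finBasis F W
  have hmem : ∀ j, u j ∈ W := fun j => Submodule.subset_span ⟨j, rfl⟩
  let a : Fin k → Fin (Module.finrank F W) → F := fun j i => b.repr ⟨u j, hmem j⟩ i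
  have hua : ∀ j, u j = ∑ i, a j i • (b i : E) := by
    intro j
    have h1 := congrArg Subtype.val (b.sum_repr ⟨u j, hmem j⟩)
    rw [Submodule.coe_sum] at h1
    exact h1.symm
  have hb : LinearIndependent F fun i => (b i : E) :=
    b.linearIndependent.map' W.subtype W.ker_subtype
  have hy : (fun i => ∑ j, a j i • x j) = 0 := by
    refine moore_mulVec_eq_zero hb fun ℓ => ?_
    have h2 := congrFun h ⟨ℓ.val, ℓ.2.trans_le hu⟩
    rw [mooreMap_apply] at h2
    simp only [Pi.zero_apply] at h2
    rw [← h2]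
    simp only [← frobeniusAlgHom_pow_apply]
    simp only [hua, map_sum, map_smul, Finset.sum_mul, Finset.mul_sum]
    rw [Finset.sum_comm]
    simp only [mul_smul_comm, smul_mul_assoc]
  have ha : ∀ i j, a j i = 0 := fun i =>
    Fintype.linearIndependent_iff.mp hx (fun j => a j i) (congrFun hy i)
  funext j
  rw [hua j]
  simp [ha]

/-- The Moore map of `u` is surjective as soon as `u` spans a space of dimension at least `s`. -/
theorem mooreMap_surjective [Finite E] {k s : ℕ} {u : Fin k → E}
    (hu : s ≤ Module.finrank F (Submodule.span F (Set.range u))) :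
    Function.Surjective (mooreMap F s u) := by
  classical
  rw [← LinearMap.range_eq_top]
  by_contra hne
  obtain ⟨f, hf0, hf⟩ := Submodule.exists_le_ker_of_lt_top _ (lt_top_iff_ne_top.mpr hne)
  have hfe : ∀ v, f v = ∑ ℓ, f (Pi.single ℓ 1) * v ℓ := by
    intro v
    conv_lhs => rw [pi_eq_sum_univ' v]
    simp [mul_comm, Pi.single]
  have hc : (fun ℓ => f (Pi.single ℓ 1)) = 0 := by
    refine linearized_eq_zero _ hu _ fun w hw => ?_
    induction hw using Submodule.span_induction with
    | mem x hx =>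
      obtain ⟨j, rfl⟩ := hx
      have h1 : f (mooreMap F s u (Pi.single j 1)) = 0 := hf ⟨_, rfl⟩
      rw [hfe] at h1
      simpa [mooreMap_apply, Pi.single_apply] using h1
    | zero => simp
    | add x y _ _ hx hy =>
      simp only [← frobeniusAlgHom_pow_apply, map_add, mul_add, Finset.sum_add_distrib] at *
      rw [hx, hy, add_zero]
    | smul a x _ hx =>
      simp only [← frobeniusAlgHom_pow_apply, map_smul, mul_smul_comm, ← Finset.smul_sum] at *
      rw [hx, smul_zero]
  apply hf0
  ext v
  simpa using congrFun hc v

/-- For `u ≠ 0`, the number of linearly independent `x` killed by the Moore map of `u` is at most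
`|E|^{k-s}`. -/
theorem ncard_mooreMap_eq_zero [Finite E] {k s : ℕ} {u : Fin k → E} (hu : u ≠ 0) :
    {x | LinearIndependent F x ∧ mooreMap F s u x = 0}.ncard * Nat.card E ^ s ≤
      Nat.card E ^ k := by
  rcases le_total s (Module.finrank F (Submodule.span F (Set.range u))) with h | h
  · have h1 := ncard_ker_mul_card _ (mooreMap_surjective h)
    simp only [Nat.card_fun, Nat.card_fin] at h1
    rw [← h1]
    exact Nat.mul_le_mul_right _ (Set.ncard_le_ncard fun x hx => hx.2)
  · have h0 : {x | LinearIndependent F x ∧ mooreMap F s u x = 0} = ∅ :=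
      Set.eq_empty_of_forall_notMem fun x hx => hu (eq_zero_of_mooreMap_eq_zero hx.1 h hx.2)
    simp [h0]

theorem ncard_badSet_mul_le [Finite E] (s k : ℕ) (U : Submodule F E) :
    (badSet F q s k (U : Set E)).ncard * Nat.card E ^ s ≤ Nat.card U ^ k * Nat.card E ^ k := by
  classical
  have := Fintype.ofFinite U
  have h := ncard_mul_le_of_subset_iUnion (S := badSet F q s k (U : Set E))
    (t := fun u : Fin k → U => {x | LinearIndependent F x ∧ (fun j => (u j : E)) ≠ 0 ∧
      mooreMap F s (fun j => (u j : E)) x = 0}) (a := Nat.card E ^ s) (b := Nat.card E ^ k) ?_ ?_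
  · simpa only [← Nat.card_eq_fintype_card, Nat.card_fun, Nat.card_fin] using h
  · rintro x ⟨hx, u, hU, hu, h⟩
    refine Set.mem_iUnion.mpr ⟨fun j => ⟨u j, hU j⟩, hx, hu, ?_⟩
    funext ℓ
    exact h (ℓ.val + 1) (by omega) (by omega)
  · intro u
    by_cases hu : (fun j => (u j : E)) = 0
    · simp [hu]
    · simpa [hu] using ncard_mooreMap_eq_zero hu

/-- The number of linearly dependent vectors of length `k` is at most `q^k |E|^{k-1}`. -/
theorem ncard_compl_OmegaSet_mul_le [Finite E] (k : ℕ) :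
    (OmegaSet F E k)ᶜ.ncard * Nat.card E ≤ q ^ k * Nat.card E ^ k := by
  classical
  have h := ncard_mul_le_of_subset_iUnion (S := (OmegaSet F E k)ᶜ)
    (t := fun a : Fin k → F => {x | a ≠ 0 ∧ ∑ j, a j • x j = 0})
    (a := Nat.card E) (b := Nat.card E ^ k) ?_ ?_
  · simpa using h
  · intro x hx
    have h1 : ¬ LinearIndependent F x := hx
    rw [Fintype.not_linearIndependent_iff] at h1
    obtain ⟨a, ha, j, hj⟩ := h1
    exact Set.mem_iUnion.mpr ⟨a, fun h0 => hj (congrFun h0 j), ha⟩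
  · intro a
    by_cases ha : a = 0
    · simp [ha]
    · obtain ⟨j, hj⟩ := Function.ne_iff.mp ha
      let f : (Fin k → E) →ₗ[F] E := ∑ j, a j • LinearMap.proj j
      have hf : ∀ x, f x = ∑ j, a j • x j := fun x => by simp [f]
      have hs : Function.Surjective f := fun y =>
        ⟨Pi.single j ((a j)⁻¹ • y), by
          rw [hf, Finset.sum_eq_single j]
          · simp [smul_smul, mul_inv_cancel₀ hj]
          · intro i _ hi
            simp [hi]
          · simp⟩
      have h1 := ncard_ker_mul_card f hs
      simp only [hf, Nat.card_fun, Nat.card_fin] at h1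
      simp [ha, h1]

end Moore

/-- If `q = 2`, `1 ≤ s < d ≤ m`, `2 ≤ r ≤ m - 1`, and `ms ≥ d(m-r) + 1`, then
for every `F_2`-subspace `U ⊆ F_{2^m}` of dimension `d`, at least a fraction `1/3` of the
vectors of `Ω` lie outside `bad(U)`: `3·|Ω \ bad(U)| ≥ |Ω|`. -/
theorem stmt_7 {F E : Type*} [Field F] [Fintype F] [Field E] [Fintype E] [Algebra F E]
    (q m s d r : ℕ) (hq : Fintype.card F = q) (hq2 : q = 2) (hm : Module.finrank F E = m)
    (hs1 : 1 ≤ s) (hsd : s < d) (hdm : d ≤ m)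
    (hr2 : 2 ≤ r) (hrm : r ≤ m - 1) (hms : d * (m - r) + 1 ≤ m * s)
    (U : Submodule F E) (hU : Module.finrank F U = d) :
    (OmegaSet F E (m - r)).ncard ≤
      3 * (OmegaSet F E (m - r) \ badSet F q s (m - r) (U : Set E)).ncard := by
  have hE : Nat.card E = 2 ^ m := by
    rw [Module.natCard_eq_pow_finrank (K := F), hm, Nat.card_eq_fintype_card, hq, hq2]
  have hUc : Nat.card U = 2 ^ d := by
    rw [Module.natCard_eq_pow_finrank (K := F), hU, Nat.card_eq_fintype_card, hq, hq2]
  have hbad := ncard_badSet_mul_le s (m - r) U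
  have hdep := ncard_compl_OmegaSet_mul_le (F := F) (E := E) (m - r)
  have htotal := Set.ncard_add_ncard_compl (OmegaSet F E (m - r))
  rw [Nat.card_fun, Nat.card_fin] at htotal
  have hdiff := Set.le_ncard_sdiff (badSet F q s (m - r) (U : Set E)) (OmegaSet F E (m - r))
  rw [hq] at hbad hdep
  rw [hE] at hbad hdep htotal
  rw [hUc, ← pow_mul, ← pow_mul] at hbad
  rw [hq2] at hdep
  have hbad' : 2 * (badSet F q s (m - r) (U : Set E)).ncard ≤ (2 ^ m) ^ (m - r) := by
    refine Nat.le_of_mul_le_mul_left ?_ (pow_pos (two_pos (α := ℕ)) (d * (m - r)))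
    calc _ = (badSet F q s (m - r) (U : Set E)).ncard * 2 ^ (d * (m - r) + 1) := by ring
      _ ≤ (badSet F q s (m - r) (U : Set E)).ncard * 2 ^ (m * s) :=
        Nat.mul_le_mul_left _ (Nat.pow_le_pow_right two_pos hms)
      _ ≤ _ := hbad
  have hdep' : 4 * (OmegaSet F E (m - r))ᶜ.ncard ≤ (2 ^ m) ^ (m - r) := by
    refine Nat.le_of_mul_le_mul_left ?_ (pow_pos (two_pos (α := ℕ)) (m - r))
    calc _ = (OmegaSet F E (m - r))ᶜ.ncard * 2 ^ (m - r + 2) := by ring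
      _ ≤ (OmegaSet F E (m - r))ᶜ.ncard * 2 ^ m :=
        Nat.mul_le_mul_left _ (Nat.pow_le_pow_right two_pos (by omega))
      _ ≤ _ := hdep
  omega
end

section
/- Let s ≥ 1 and let U, V be F_q-linear subspaces of F_{q^m} of dimensions d and r respectively. Then the following two conditions are equivalent: (i) for every F_q-basis u_1,…,u_d of U and all v′_1,…,v′_d ∈ V^⊥, if ∑_{i=1}^d v′_i u_i^{q^ℓ} = 0 for every 1 ≤ ℓ ≤ s then v′_1 = … = v′_d = 0; (ii) for every F_q-basis b′_1,…,b′_{m−r} of V^⊥ and all w_1,…,w_{m−r} ∈ U, if ∑_{j=1}^{m−r} w_j^{q^ℓ} b′_j = 0 for every 1 ≤ ℓ ≤ s then w_1 = … = w_{m−r} = 0. -/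
open Finset

/-- The trace-dual of an `F`-subspace `V` of `E`, where `Tr(x) = ∑_{i<m} x^{q^i}`:
`V^⊥ = {x : ∀ v ∈ V, Tr(v*x) = 0}`. -/
def traceDual {F E : Type*} [Field F] [Fintype F] [Field E] [Fintype E] [Algebra F E]
    (q m : ℕ) (hq : Fintype.card F = q) (V : Submodule F E) : Submodule F E where
  carrier := {x : E | ∀ v ∈ V, ∑ i ∈ Finset.range m, (v * x) ^ q ^ i = 0}
  zero_mem' := by
    intro v hv
    have hq0 : q ≠ 0 := by
      have h1 : 0 < Fintype.card F := Fintype.card_pos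
      omega
    refine Finset.sum_eq_zero fun i _ => ?_
    rw [mul_zero, zero_pow (pow_ne_zero i hq0)]
  add_mem' := by
    intro x y hx hy v hv
    obtain ⟨n, hp, hcard⟩ := FiniteField.card F (ringChar F)
    haveI : Fact (Nat.Prime (ringChar F)) := ⟨hp⟩
    haveI : CharP E (ringChar F) :=
      charP_of_injective_algebraMap (algebraMap F E).injective (ringChar F)
    have hq' : q = ringChar F ^ (n : ℕ) := by rw [← hq, hcard]
    have key : ∀ a b : E, ∀ i : ℕ, (a + b) ^ q ^ i = a ^ q ^ i + b ^ q ^ i := by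
      intro a b i
      rw [hq', ← pow_mul]
      exact add_pow_char_pow a b (ringChar F) ((n : ℕ) * i)
    calc ∑ i ∈ Finset.range m, (v * (x + y)) ^ q ^ i
        = ∑ i ∈ Finset.range m, ((v * x) ^ q ^ i + (v * y) ^ q ^ i) := by
          refine Finset.sum_congr rfl fun i _ => ?_
          rw [mul_add, key]
      _ = 0 := by rw [Finset.sum_add_distrib, hx v hv, hy v hv, add_zero]
  smul_mem' := by
    intro c x hx v hv
    have hc : ∀ i : ℕ, (algebraMap F E c) ^ q ^ i = algebraMap F E c := by
      intro i
      rw [← map_pow]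
      congr 1
      calc c ^ q ^ i = c ^ Fintype.card F ^ i := by rw [hq]
        _ = c := FiniteField.pow_card_pow i c
    calc ∑ i ∈ Finset.range m, (v * (c • x)) ^ q ^ i
        = ∑ i ∈ Finset.range m, algebraMap F E c * (v * x) ^ q ^ i := by
          refine Finset.sum_congr rfl fun i _ => ?_
          rw [Algebra.smul_def, mul_left_comm, mul_pow, hc]
      _ = algebraMap F E c * ∑ i ∈ Finset.range m, (v * x) ^ q ^ i := (Finset.mul_sum _ _ _).symm
      _ = 0 := by rw [hx v hv, mul_zero]

/-- Expanding `x` along the family `p` exchanges the roles of two families in the bilinear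
expressions `∑ f (xⱼ) * g (cⱼ)`. -/
theorem exists_exchange_sum_mul {F E ι κ : Type*} [Field F] [Field E] [Algebra F E]
    [Fintype ι] [Fintype κ] (p : ι → E) (c x : κ → E) (hc : LinearIndependent F c)
    (hx : ∀ j, x j ∈ Submodule.span F (Set.range p)) :
    ∃ y : ι → E, (∀ i, y i ∈ Submodule.span F (Set.range c)) ∧
      (∀ f g : E →ₗ[F] E, ∑ i, f (p i) * g (y i) = ∑ j, f (x j) * g (c j)) ∧
      ((∀ i, y i = 0) → ∀ j, x j = 0) := by
  choose a ha using fun j => (Submodule.mem_span_range_iff_exists_fun F).1 (hx j)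
  refine ⟨fun i => ∑ j, a j i • c j, fun i => Submodule.sum_mem _ fun j _ =>
    Submodule.smul_mem _ _ (Submodule.subset_span ⟨j, rfl⟩), fun f g => ?_, fun h j => ?_⟩
  · simp only [← ha, map_sum, map_smul, Finset.mul_sum, Finset.sum_mul, smul_mul_assoc,
      mul_smul_comm]
    exact Finset.sum_comm
  · rw [← ha j]
    exact Finset.sum_eq_zero fun i _ => by
      rw [Fintype.linearIndependent_iff.1 hc (fun j => a j i) (h i) j, zero_smul]

theorem exists_linearMap_pow_card_pow (F E : Type*) [Field F] [Fintype F] [Field E] [Algebra F E]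
    (n : ℕ) : ∃ f : E →ₗ[F] E, ∀ x, f x = x ^ Fintype.card F ^ n :=
  ⟨(FiniteField.frobeniusAlgHom F E ^ n).toLinearMap, fun x => by
    simp [AlgHom.coe_pow, FiniteField.coe_frobeniusAlgHom, pow_iterate]⟩

theorem exists_linearIndependent_span_eq {F E : Type*} [Field F] [Field E] [Algebra F E]
    [FiniteDimensional F E] (U : Submodule F E) {n : ℕ} (h : Module.finrank F U = n) :
    ∃ u : Fin n → E, (∀ i, u i ∈ U) ∧ LinearIndependent F u ∧
      Submodule.span F (Set.range u) = U := by
  let b := Module.finBasisOfFinrankEq F U h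
  refine ⟨fun i => b i, fun i => (b i).2,
    b.linearIndependent.map' U.subtype U.ker_subtype, ?_⟩
  have := congrArg (Submodule.map U.subtype) b.span_eq
  rwa [Submodule.map_span, ← Set.range_comp, Submodule.map_top, Submodule.range_subtype] at this

theorem traceDual_eq_orthogonal {F E : Type*} [Field F] [Fintype F] [Field E] [Fintype E]
    [Algebra F E] (q m : ℕ) (hq : Fintype.card F = q) (hm : Module.finrank F E = m)
    (V : Submodule F E) : traceDual q m hq V = (Algebra.traceForm F E).orthogonal V := by
  ext x
  change (∀ v ∈ V, ∑ i ∈ Finset.range m, (v * x) ^ q ^ i = 0) ↔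
    ∀ v ∈ V, Algebra.trace F E (v * x) = 0
  refine forall₂_congr fun v _ => ?_
  rw [← map_eq_zero (algebraMap F E), FiniteField.algebraMap_trace_eq_sum_pow,
    Nat.card_eq_fintype_card, hq, hm]

theorem finrank_traceDual {F E : Type*} [Field F] [Fintype F] [Field E] [Fintype E]
    [Algebra F E] (q m : ℕ) (hq : Fintype.card F = q) (hm : Module.finrank F E = m)
    (V : Submodule F E) :
    Module.finrank F (traceDual q m hq V) = m - Module.finrank F V := by
  rw [traceDual_eq_orthogonal q m hq hm, LinearMap.BilinForm.finrank_orthogonal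
    (traceForm_nondegenerate F E), hm]

/-- For `F_q`-subspaces `U, V ⊆ F_{q^m}` of dimensions `d` and `r`, the
following are equivalent: (i) for every basis `u₁,…,u_d` of `U` and all `v'ᵢ ∈ V^⊥`, if
`∑ᵢ v'ᵢ uᵢ^{q^ℓ} = 0` for every `1 ≤ ℓ ≤ s` then all `v'ᵢ = 0`; (ii) for every basis
`b'₁,…,b'_{m-r}` of `V^⊥` and all `wⱼ ∈ U`, if `∑ⱼ wⱼ^{q^ℓ} b'ⱼ = 0` for every `1 ≤ ℓ ≤ s`
then all `wⱼ = 0`. -/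
theorem stmt_12 {F E : Type*} [Field F] [Fintype F] [Field E] [Fintype E] [Algebra F E]
    (q m s d r : ℕ) (hq : Fintype.card F = q) (hm : Module.finrank F E = m) (hs1 : 1 ≤ s)
    (U V : Submodule F E) (hU : Module.finrank F U = d) (hV : Module.finrank F V = r) :
    (∀ u : Fin d → E,
      (∀ i, u i ∈ U) → LinearIndependent F u → Submodule.span F (Set.range u) = U →
      ∀ v' : Fin d → E, (∀ i, v' i ∈ traceDual q m hq V) →
        (∀ ℓ : ℕ, 1 ≤ ℓ → ℓ ≤ s → ∑ i, v' i * u i ^ q ^ ℓ = 0) →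
        ∀ i, v' i = 0) ↔
    (∀ b' : Fin (m - r) → E,
      (∀ j, b' j ∈ traceDual q m hq V) → LinearIndependent F b' →
        Submodule.span F (Set.range b') = traceDual q m hq V →
      ∀ w : Fin (m - r) → E, (∀ j, w j ∈ U) →
        (∀ ℓ : ℕ, 1 ≤ ℓ → ℓ ≤ s → ∑ j, w j ^ q ^ ℓ * b' j = 0) →
        ∀ j, w j = 0) := by
  subst hq
  constructor
  · intro h b' _ hbl hbs w hwU hw
    obtain ⟨u, huU, hul, hus⟩ := exists_linearIndependent_span_eq U hU
    obtain ⟨y, hy, hsum, hzero⟩ := exists_exchange_sum_mul u b' w hbl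
      fun j => hus.symm ▸ hwU j
    refine hzero (h u huU hul hus y (fun i => hbs ▸ hy i) fun ℓ h1 h2 => ?_)
    obtain ⟨f, hf⟩ := exists_linearMap_pow_card_pow F E ℓ
    have := hsum f LinearMap.id
    simp only [hf, LinearMap.id_apply, hw ℓ h1 h2] at this
    simpa only [mul_comm] using this
  · intro h u _ hul hus v' hv' hv
    obtain ⟨b', hbV, hbl, hbs⟩ := exists_linearIndependent_span_eq _
      ((finrank_traceDual _ m rfl hm V).trans (by rw [hV]))
    obtain ⟨y, hy, hsum, hzero⟩ := exists_exchange_sum_mul b' u v' hul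
      fun j => hbs.symm ▸ hv' j
    refine hzero (h b' hbV hbl hbs y (fun i => hus ▸ hy i) fun ℓ h1 h2 => ?_)
    obtain ⟨f, hf⟩ := exists_linearMap_pow_card_pow F E ℓ
    have := hsum LinearMap.id f
    simp only [hf, LinearMap.id_apply, hv ℓ h1 h2] at this
    simpa only [mul_comm] using this
end

section
/- Assume 1 ≤ s < d < m, 1 ≤ r ≤ m−1, ms ≥ d(m−r), and r ≥ m − s. Then for every F_q-linear subspace U ⊆ F_{q^m} of dimension d, bad(U) = ∅; that is, for every (x_1,…,x_{m−r}) ∈ (F_{q^m})^{m−r} with F_q-linearly independent entries and every nonzero (u_1,…,u_{m−r}) ∈ U^{m−r}, there exists some 1 ≤ ℓ ≤ s with ∑_{j=1}^{m−r} u_j^{q^ℓ} x_j ≠ 0. -/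
open Finset

theorem frobeniusAlgHom_pow_apply_s15 (F : Type*) {E : Type*} [Field F] [Fintype F] [Field E]
    [Algebra F E] (n : ℕ) (y : E) :
    (FiniteField.frobeniusAlgHom F E ^ n) y = y ^ Fintype.card F ^ n := by
  rw [AlgHom.coe_pow, FiniteField.coe_frobeniusAlgHom, pow_iterate]

/-- The Moore matrix of a linearly independent family has nonzero determinant. -/
theorem det_moore_ne_zero {F E : Type*} [Field F] [Fintype F] [Field E] [Algebra F E] {k : ℕ}
    {x : Fin k → E} (hx : LinearIndependent F x) :
    (Matrix.of fun i j : Fin k => x j ^ Fintype.card F ^ (i : ℕ)).det ≠ 0 := by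
  classical
  intro hdet
  obtain ⟨c, hc, hcx⟩ := Matrix.exists_vecMul_eq_zero_iff.mpr hdet
  have hq : 1 < Fintype.card F := Fintype.one_lt_card
  have hcx' (j : Fin k) : ∑ i : Fin k, c i * x j ^ Fintype.card F ^ (i : ℕ) = 0 :=
    congrFun hcx j
  set P : Polynomial E :=
    ∑ i : Fin k, Polynomial.C (c i) * Polynomial.X ^ Fintype.card F ^ (i : ℕ) with hP
  have hdeg : P.natDegree < Fintype.card (Fin k → F) := by
    rw [Fintype.card_fun, Fintype.card_fin]
    refine (Polynomial.natDegree_sum_le_of_forall_le (n := Fintype.card F ^ k - 1) _ _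
      fun i _ => ?_).trans_lt (Nat.sub_lt (by positivity) one_pos)
    exact (Polynomial.natDegree_C_mul_X_pow_le _ _).trans
      (Nat.le_sub_one_of_lt (Nat.pow_lt_pow_right hq i.isLt))
  have hinj : Function.Injective fun a : Fin k → F => ∑ j, a j • x j := by
    intro a b hab
    exact hx.fintypeLinearCombination_injective
      (by simpa [Fintype.linearCombination_apply] using hab)
  have hP0 : P = 0 := by
    refine Polynomial.eq_zero_of_natDegree_lt_card_of_eval_eq_zero P hinj (fun a => ?_) hdeg
    simp only [hP, Polynomial.eval_finsetSum, Polynomial.eval_mul, Polynomial.eval_C,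
      Polynomial.eval_pow, Polynomial.eval_X, ← frobeniusAlgHom_pow_apply_s15, map_sum, map_smul,
      Finset.mul_sum]
    rw [Finset.sum_comm]
    refine Finset.sum_eq_zero fun j _ => ?_
    simp only [frobeniusAlgHom_pow_apply_s15, mul_smul_comm, ← Finset.smul_sum, hcx', smul_zero]
  refine hc (funext fun i => ?_)
  have hcoeff := congrArg (fun p => Polynomial.coeff p (Fintype.card F ^ (i : ℕ))) hP0
  simpa [hP, Polynomial.finsetSum_coeff, Polynomial.coeff_X_pow,
    Nat.pow_right_inj hq, Fin.val_inj] using hcoeff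

/-- If `1 ≤ s < d < m`, `1 ≤ r ≤ m - 1`, `ms ≥ d(m-r)` and `r ≥ m - s`, then
for every `F_q`-subspace `U ⊆ F_{q^m}` of dimension `d`, `bad(U) = ∅`. -/
theorem stmt_15 {F E : Type*} [Field F] [Fintype F] [Field E] [Fintype E] [Algebra F E]
    (q m s d r : ℕ) (hq : Fintype.card F = q) (hm : Module.finrank F E = m)
    (hs1 : 1 ≤ s) (hsd : s < d) (hdm : d < m) (hr1 : 1 ≤ r) (hrm : r ≤ m - 1)
    (hms : d * (m - r) ≤ m * s) (hrs : m - s ≤ r)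
    (U : Submodule F E) (hU : Module.finrank F U = d) :
    badSet F q s (m - r) (U : Set E) = ∅ := by
  subst hq
  refine Set.eq_empty_of_forall_notMem fun x => ?_
  rintro ⟨hx, u, -, hu, h⟩
  refine det_moore_ne_zero hx (Matrix.exists_mulVec_eq_zero_iff.mp
    ⟨fun j => u j ^ Fintype.card F ^ s, fun h0 => hu (funext fun j => ?_), funext fun i => ?_⟩)
  · exact eq_zero_of_pow_eq_zero (congrFun h0 j)
  · have his : (i : ℕ) < s := by omega
    have key := congrArg (FiniteField.frobeniusAlgHom F E ^ (i : ℕ))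
      (h (s - i) (by omega) (Nat.sub_le _ _))
    simp only [map_sum, map_mul, map_zero, frobeniusAlgHom_pow_apply_s15, ← pow_mul, ← pow_add,
      Nat.sub_add_cancel his.le] at key
    simpa [Matrix.mulVec, dotProduct, mul_comm] using key
end
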